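/- Let w ∈ A0_xy. Then: the number of z ∈ A0_xy adjacent to w such that the edge wz has type 0 equals 2q^i − q − 2; the number of z ∈ A+_xy adjacent to w such that the edge wz has type + equals q^{i+1}·[n−k−i]; the number of z ∈ A−_xy adjacent to w such that the edge wz has type − equals q^{i+1}·[k−i]; and for every other pair (N, t) with N among A0_xy, A+_xy, A−_xy and t among the types 0, +, −, the number of z ∈ N adjacent to w such that the edge wz has type t equals 0. -/

import Mathlib

open scoped Classical

noncomputable section

variable {F V : Type} [Field F] [AddCommGroup V] [Module F V]

/-- `v` covers `u` in the projective geometry `P`. -/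
def Covers (u v : Submodule F V) : Prop :=
  u ≤ v ∧ Module.finrank F ↥v = Module.finrank F ↥u + 1

/-- `v` slash-covers `u` (relative to the fixed subspace `y`). -/
def SlashCovers (y u v : Submodule F V) : Prop :=
  Covers u v ∧ Module.finrank F ↥(v ⊓ y) = Module.finrank F ↥(u ⊓ y) + 1

/-- `v` backslash-covers `u` (relative to the fixed subspace `y`). -/
def BackslashCovers (y u v : Submodule F V) : Prop :=
  Covers u v ∧ Module.finrank F ↥(v ⊓ y) = Module.finrank F ↥(u ⊓ y)

/-- `q` raised to a real exponent, as a complex number. -/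
def qpow (q : ℕ) (e : ℝ) : ℂ := (((q : ℝ) ^ e : ℝ) : ℂ)

/-- The Gaussian bracket `[m] = (q^m - 1)/(q - 1)` as a rational number. -/
def gaussQ (q m : ℕ) : ℚ := ((q : ℚ) ^ m - 1) / ((q : ℚ) - 1)

/-- The Gaussian bracket `[m] = (q^m - 1)/(q - 1)` as a complex number. -/
def gaussC (q m : ℕ) : ℂ := ((q : ℂ) ^ m - 1) / ((q : ℂ) - 1)

/-- The diagonal matrix `K1`; the `(u,u)` entry is `q^(k/2 - i)` for `u ∈ P_{i,j}`. -/
def matK1 (q k : ℕ) (y : Submodule F V) : Matrix (Submodule F V) (Submodule F V) ℂ :=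
  Matrix.diagonal fun u => qpow q ((k : ℝ) / 2 - (Module.finrank F ↥(u ⊓ y) : ℝ))

/-- The diagonal matrix `K2`; the `(u,u)` entry is `q^(j - (n-k)/2)` for `u ∈ P_{i,j}`. -/
def matK2 (q n k : ℕ) (y : Submodule F V) : Matrix (Submodule F V) (Submodule F V) ℂ :=
  Matrix.diagonal fun u =>
    qpow q (((Module.finrank F ↥u : ℝ) - (Module.finrank F ↥(u ⊓ y) : ℝ))
      - ((n : ℝ) - (k : ℝ)) / 2)

/-- The 0-1 matrix `L1`; the `(u,v)` entry is `1` iff `v` slash-covers `u`. -/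
def matL1 (y : Submodule F V) : Matrix (Submodule F V) (Submodule F V) ℂ :=
  Matrix.of fun u v => if SlashCovers y u v then (1 : ℂ) else 0

/-- The 0-1 matrix `L2`; the `(u,v)` entry is `1` iff `v` backslash-covers `u`. -/
def matL2 (y : Submodule F V) : Matrix (Submodule F V) (Submodule F V) ℂ :=
  Matrix.of fun u v => if BackslashCovers y u v then (1 : ℂ) else 0

/-- `R1 = L1ᵀ`. -/
def matR1 (y : Submodule F V) : Matrix (Submodule F V) (Submodule F V) ℂ := Matrix.transpose (matL1 y)

/-- `R2 = L2ᵀ`. -/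
def matR2 (y : Submodule F V) : Matrix (Submodule F V) (Submodule F V) ℂ := Matrix.transpose (matL2 y)

/-- `R = L1 · R2`. -/
def matR [Fintype (Submodule F V)] (y : Submodule F V) :
    Matrix (Submodule F V) (Submodule F V) ℂ := matL1 y * matR2 y

/-- `L = R1 · L2`. -/
def matL [Fintype (Submodule F V)] (y : Submodule F V) :
    Matrix (Submodule F V) (Submodule F V) ℂ := matR1 y * matL2 y

/-- The 0-1 matrix `F0`. -/
def matF0 (y : Submodule F V) : Matrix (Submodule F V) (Submodule F V) ℂ :=
  Matrix.of fun u v =>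
    if SlashCovers y u (u ⊔ v) ∧ SlashCovers y v (u ⊔ v) ∧
        BackslashCovers y (u ⊓ v) u ∧ BackslashCovers y (u ⊓ v) v then (1 : ℂ) else 0

/-- The 0-1 matrix `F+`. -/
def matFp (y : Submodule F V) : Matrix (Submodule F V) (Submodule F V) ℂ :=
  Matrix.of fun u v =>
    if BackslashCovers y u (u ⊔ v) ∧ BackslashCovers y v (u ⊔ v) then (1 : ℂ) else 0

/-- The 0-1 matrix `F-`. -/
def matFm (y : Submodule F V) : Matrix (Submodule F V) (Submodule F V) ℂ :=
  Matrix.of fun u v =>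
    if SlashCovers y (u ⊓ v) u ∧ SlashCovers y (u ⊓ v) v then (1 : ℂ) else 0

/-- The vertex set `X` of the Grassmann graph: `k`-dimensional subspaces of `V`. -/
abbrev GrassVertex (F V : Type) [Field F] [AddCommGroup V] [Module F V] (k : ℕ) :=
  {z : Submodule F V // Module.finrank F ↥z = k}

/-- The Grassmann graph `J_q(n,k)`: vertices are adjacent iff their intersection
has dimension `k - 1`. -/
def Grass (F V : Type) [Field F] [AddCommGroup V] [Module F V] (k : ℕ) :
    SimpleGraph (GrassVertex F V k) :=
  SimpleGraph.fromRel fun a b => Module.finrank F ↥(a.1 ⊓ b.1) = k - 1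

/-- `B_xy = {z ∈ Γ(x) : ∂(z,y) = ∂(x,y) + 1}`. -/
def Bset {k : ℕ} (x y : GrassVertex F V k) : Set (GrassVertex F V k) :=
  {z | (Grass F V k).Adj x z ∧ (Grass F V k).dist z y = (Grass F V k).dist x y + 1}

/-- `C_xy = {z ∈ Γ(x) : ∂(z,y) = ∂(x,y) - 1}`. -/
def Cset {k : ℕ} (x y : GrassVertex F V k) : Set (GrassVertex F V k) :=
  {z | (Grass F V k).Adj x z ∧ (Grass F V k).dist z y = (Grass F V k).dist x y - 1}

/-- `A_xy = {z ∈ Γ(x) : ∂(z,y) = ∂(x,y)}`. -/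
def Aset {k : ℕ} (x y : GrassVertex F V k) : Set (GrassVertex F V k) :=
  {z | (Grass F V k).Adj x z ∧ (Grass F V k).dist z y = (Grass F V k).dist x y}

/-- `A0_xy`. -/
def A0set {k : ℕ} (x y : GrassVertex F V k) : Set (GrassVertex F V k) :=
  {z | (Grass F V k).Adj x z ∧
    SlashCovers y.1 z.1 (z.1 ⊔ x.1) ∧ SlashCovers y.1 x.1 (z.1 ⊔ x.1) ∧
    BackslashCovers y.1 (z.1 ⊓ x.1) z.1 ∧ BackslashCovers y.1 (z.1 ⊓ x.1) x.1}

/-- `A+_xy`. -/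
def Apset {k : ℕ} (x y : GrassVertex F V k) : Set (GrassVertex F V k) :=
  {z | (Grass F V k).Adj x z ∧
    BackslashCovers y.1 z.1 (z.1 ⊔ x.1) ∧ BackslashCovers y.1 x.1 (z.1 ⊔ x.1)}

/-- `A-_xy`. -/
def Amset {k : ℕ} (x y : GrassVertex F V k) : Set (GrassVertex F V k) :=
  {z | (Grass F V k).Adj x z ∧
    SlashCovers y.1 (z.1 ⊓ x.1) z.1 ∧ SlashCovers y.1 (z.1 ⊓ x.1) x.1}

/-- The edge `wz` has type `0`. -/
def EdgeType0 {k : ℕ} (y w z : GrassVertex F V k) : Prop :=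
  SlashCovers y.1 w.1 (w.1 ⊔ z.1) ∧ SlashCovers y.1 z.1 (w.1 ⊔ z.1) ∧
  BackslashCovers y.1 (w.1 ⊓ z.1) w.1 ∧ BackslashCovers y.1 (w.1 ⊓ z.1) z.1

/-- The edge `wz` has type `+`. -/
def EdgeTypeP {k : ℕ} (y w z : GrassVertex F V k) : Prop :=
  BackslashCovers y.1 w.1 (w.1 ⊔ z.1) ∧ BackslashCovers y.1 z.1 (w.1 ⊔ z.1)

/-- The edge `wz` has type `-`. -/
def EdgeTypeM {k : ℕ} (y w z : GrassVertex F V k) : Prop :=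
  SlashCovers y.1 (w.1 ⊓ z.1) w.1 ∧ SlashCovers y.1 (w.1 ⊓ z.1) z.1

open Module

theorem ncard_coe_submodule [Fintype F] [FiniteDimensional F V] (U : Submodule F V) :
    (U : Set V).ncard = Fintype.card F ^ finrank F U := by
  rw [← Nat.card_coe_set_eq, ← Nat.card_eq_fintype_card]
  exact Module.natCard_eq_pow_finrank (K := F) (V := U)

/-- The number of one-dimensional extensions of `H` inside `A` that are not contained in `U`. -/
theorem ncard_extensions [Fintype F] [FiniteDimensional F V] {H U A : Submodule F V}
    (hHU : H ≤ U) (hUA : U ≤ A) :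
    ({z : Submodule F V | finrank F z = finrank F H + 1 ∧ H ≤ z ∧ z ≤ A ∧ ¬ z ≤ U}.ncard : ℚ) *
      ((Fintype.card F : ℚ) ^ (finrank F H + 1) - (Fintype.card F : ℚ) ^ finrank F H) =
      (Fintype.card F : ℚ) ^ finrank F A - (Fintype.card F : ℚ) ^ finrank F U := by
  have : Finite V := Module.finite_of_finite F
  have : Finite (Submodule F V) :=
    Finite.of_injective (fun U : Submodule F V => (U : Set V)) SetLike.coe_injective
  have : Fintype V := Fintype.ofFinite V
  set T := {z : Submodule F V | finrank F z = finrank F H + 1 ∧ H ≤ z ∧ z ≤ A ∧ ¬ z ≤ U}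
  have hT : T.Finite := Set.toFinite T
  set S : Finset V := ((A : Set V) \ U).toFinset with hS
  have hdiff {B C : Submodule F V} (h : B ≤ C) : (((C : Set V) \ B).ncard : ℚ) =
      (Fintype.card F : ℚ) ^ finrank F C - (Fintype.card F : ℚ) ^ finrank F B := by
    have := Set.ncard_sdiff_add_ncard_of_subset (s := (B : Set V)) (t := C) h
    rw [ncard_coe_submodule, ncard_coe_submodule] at this
    rw [eq_sub_iff_add_eq]
    exact_mod_cast this
  have hmaps : Set.MapsTo (fun v => H ⊔ F ∙ v) (S : Set V) (hT.toFinset : Set (Submodule F V)) := by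
    intro v hv
    simp only [hS, Set.coe_toFinset, Set.mem_sdiff, SetLike.mem_coe] at hv
    simp only [Set.Finite.coe_toFinset]
    refine ⟨Submodule.finrank_sup_span_singleton fun h => hv.2 (hHU h), le_sup_left, ?_, ?_⟩
    · exact sup_le (hHU.trans hUA) ((Submodule.span_singleton_le_iff_mem _ _).2 hv.1)
    · exact fun h => hv.2 (h (le_sup_right (a := H) (Submodule.mem_span_singleton_self v)))
  have hcount := Finset.card_eq_sum_card_fiberwise hmaps
  have hfib : ∀ z ∈ hT.toFinset, (({v ∈ S | H ⊔ F ∙ v = z}.card : ℕ) : ℚ) =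
      (Fintype.card F : ℚ) ^ (finrank F H + 1) - (Fintype.card F : ℚ) ^ finrank F H := by
    intro z hz
    obtain ⟨hz1, hz2, hz3, hz4⟩ := hT.mem_toFinset.1 hz
    rw [← hz1, ← hdiff hz2, ← Set.ncard_coe_finset]
    congr 2
    ext v
    simp only [hS, Finset.coe_filter, Set.mem_toFinset, Set.mem_sdiff, SetLike.mem_coe,
      Set.mem_ofPred_eq]
    constructor
    · rintro ⟨⟨_, h2⟩, rfl⟩
      exact ⟨le_sup_right (a := H) (Submodule.mem_span_singleton_self v), fun h => h2 (hHU h)⟩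
    · rintro ⟨h1, h2⟩
      have hle : H ⊔ F ∙ v ≤ z := sup_le hz2 ((Submodule.span_singleton_le_iff_mem _ _).2 h1)
      have heq : H ⊔ F ∙ v = z :=
        Submodule.eq_of_le_of_finrank_eq hle (by rw [Submodule.finrank_sup_span_singleton h2, hz1])
      refine ⟨⟨hz3 h1, fun h => hz4 ?_⟩, heq⟩
      rw [← heq]
      exact sup_le hHU ((Submodule.span_singleton_le_iff_mem _ _).2 h)
  rw [← hdiff hUA, Set.ncard_eq_toFinset_card _ hT, Set.ncard_eq_toFinset_card', ← hS, hcount]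
  push_cast
  rw [Finset.sum_congr rfl hfib, Finset.sum_const, nsmul_eq_mul]

/-- The number of hyperplanes of `K` that contain `E` and do not contain `D`. -/
theorem ncard_hyperplanes [Fintype F] [FiniteDimensional F V] {E D K : Submodule F V}
    (hED : E ≤ D) (hDK : D ≤ K) :
    ({z : Submodule F V | finrank F z + 1 = finrank F K ∧ E ≤ z ∧ z ≤ K ∧ ¬ D ≤ z}.ncard : ℚ) *
      ((Fintype.card F : ℚ) ^ (finrank F V - finrank F K + 1) -
        (Fintype.card F : ℚ) ^ (finrank F V - finrank F K)) =
      (Fintype.card F : ℚ) ^ (finrank F V - finrank F E) -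
        (Fintype.card F : ℚ) ^ (finrank F V - finrank F D) := by
  have hrank (W : Submodule F V) :
      finrank F W.dualAnnihilator = finrank F V - finrank F W := by
    have := Subspace.finrank_add_finrank_dualAnnihilator_eq W
    omega
  have hle {W W' : Submodule F V} : W.dualAnnihilator ≤ W'.dualAnnihilator ↔ W' ≤ W :=
    Subspace.dualAnnihilator_le_dualAnnihilator_iff
  have key := ncard_extensions (F := F) (V := Dual F V) (hle.2 hDK) (hle.2 hED)
  rw [hrank, hrank, hrank] at key
  have hinj : Function.Injective (Submodule.dualAnnihilator (R := F) (M := V)) :=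
    fun _ _ h => le_antisymm (hle.1 h.ge) (hle.1 h.le)
  rw [← key, ← Set.ncard_image_of_injective _ hinj]
  congr 3
  ext z'
  have hKV := Submodule.finrank_le K
  constructor
  · rintro ⟨z, ⟨h1, h2, h3, h4⟩, rfl⟩
    refine ⟨?_, hle.2 h3, hle.2 h2, fun h => h4 (hle.1 h)⟩
    rw [hrank]
    omega
  · rintro ⟨h1, h2, h3, h4⟩
    obtain ⟨z, rfl⟩ : ∃ z : Submodule F V, z.dualAnnihilator = z' :=
      ⟨_, Subspace.dualCoannihilator_dualAnnihilator_eq⟩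
    refine ⟨z, ⟨?_, hle.1 h3, hle.1 h2, fun h => h4 (hle.2 h)⟩, rfl⟩
    rw [hrank] at h1
    have := Submodule.finrank_le z
    omega

theorem ncard_grassVertex (k : ℕ) (P : Submodule F V → Prop) :
    {z : GrassVertex F V k | P z.1}.ncard = {z : Submodule F V | finrank F z = k ∧ P z}.ncard := by
  rw [← Set.ncard_image_of_injective _ Subtype.val_injective]
  congr 1
  ext z
  simp [and_comm]

theorem finrank_sup_inf [FiniteDimensional F V] (a b : Submodule F V) :
    finrank F ↥(a ⊔ b) + finrank F ↥(a ⊓ b) = finrank F a + finrank F b :=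
  Submodule.finrank_sup_add_finrank_inf_eq a b

/-- A hyperplane of `a` together with any subspace of `a` outside of it spans `a`. -/
theorem sup_eq_of_finrank [FiniteDimensional F V] {h s a : Submodule F V} (hh : h ≤ a)
    (hs : s ≤ a) (hr : finrank F a ≤ finrank F h + 1) (hsh : ¬ s ≤ h) : h ⊔ s = a := by
  refine Submodule.eq_of_le_of_finrank_le (sup_le hh hs) ?_
  have : finrank F h < finrank F ↥(h ⊔ s) :=
    Submodule.finrank_lt_finrank_of_lt (left_lt_sup.2 hsh)
  omega

theorem grass_adj_iff {k : ℕ} {a b : GrassVertex F V k} :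
    (Grass F V k).Adj a b ↔ a ≠ b ∧ finrank F ↥(a.1 ⊓ b.1) = k - 1 := by
  rw [Grass, SimpleGraph.fromRel_adj, inf_comm b.1, or_self]

theorem grass_adj_iff_of_finrank_sup [FiniteDimensional F V] {k : ℕ} {a b : GrassVertex F V k} :
    (Grass F V k).Adj a b ↔ finrank F ↥(a.1 ⊔ b.1) = k + 1 := by
  have h := finrank_sup_inf a.1 b.1
  rw [a.2, b.2] at h
  have hne : a ≠ b ↔ finrank F ↥(a.1 ⊓ b.1) ≠ k := by
    rw [not_iff_not]
    constructor
    · rintro rfl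
      rw [inf_idem, a.2]
    · intro h'
      have h1 := Submodule.eq_of_le_of_finrank_eq (inf_le_left : a.1 ⊓ b.1 ≤ a.1) (by rw [h', a.2])
      have h2 := Submodule.eq_of_le_of_finrank_eq (inf_le_right : a.1 ⊓ b.1 ≤ b.1) (by rw [h', b.2])
      exact Subtype.ext (h1.symm.trans h2)
  rw [grass_adj_iff, hne]
  have h2 := Submodule.finrank_mono (inf_le_left : a.1 ⊓ b.1 ≤ a.1)
  rw [a.2] at h2
  omega

theorem le_finrank_inf_add_length [FiniteDimensional F V] {k : ℕ} {a b : GrassVertex F V k}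
    (p : (Grass F V k).Walk a b) : k ≤ finrank F ↥(a.1 ⊓ b.1) + p.length := by
  induction p with
  | @nil u => rw [inf_idem, u.2]; exact Nat.le_add_right _ _
  | @cons u v w h p ih =>
    rw [SimpleGraph.Walk.length_cons]
    have h1 := grass_adj_iff_of_finrank_sup.1 h
    have h2 := finrank_sup_inf (u.1 ⊓ v.1) (v.1 ⊓ w.1)
    have h3 := finrank_sup_inf u.1 v.1
    have h4 : finrank F ↥((u.1 ⊓ v.1) ⊔ (v.1 ⊓ w.1)) ≤ finrank F v.1 :=
      Submodule.finrank_mono (sup_le inf_le_right inf_le_left)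
    have h5 : finrank F ↥((u.1 ⊓ v.1) ⊓ (v.1 ⊓ w.1)) ≤ finrank F ↥(u.1 ⊓ w.1) :=
      Submodule.finrank_mono (inf_le_inf inf_le_left inf_le_right)
    rw [u.2, v.2] at h3
    rw [v.2] at h4
    omega

theorem grass_adj_iff_of_finrank_inf [FiniteDimensional F V] {k : ℕ} {a b : GrassVertex F V k} :
    (Grass F V k).Adj a b ↔ finrank F ↥(a.1 ⊓ b.1) + 1 = k := by
  have h := finrank_sup_inf a.1 b.1
  rw [a.2, b.2] at h
  rw [grass_adj_iff_of_finrank_sup]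
  omega

theorem exists_walk_length_le [FiniteDimensional F V] {k : ℕ} (y : GrassVertex F V k) (d : ℕ) :
    ∀ x : GrassVertex F V k, k ≤ finrank F ↥(x.1 ⊓ y.1) + d →
      ∃ p : (Grass F V k).Walk x y, p.length ≤ d := by
  induction d with
  | zero =>
    intro x h
    obtain rfl : x = y := by
      have h1 := Submodule.eq_of_le_of_finrank_le (inf_le_left : x.1 ⊓ y.1 ≤ x.1) (x.2.trans_le h)
      have h2 := Submodule.eq_of_le_of_finrank_le (inf_le_right : x.1 ⊓ y.1 ≤ y.1) (y.2.trans_le h)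
      exact Subtype.ext (h1.symm.trans h2)
    exact ⟨.nil, le_rfl⟩
  | succ d ih =>
    intro x h
    by_cases hxy : y.1 ≤ x.1
    · obtain rfl : y = x := Subtype.ext (Submodule.eq_of_le_of_finrank_eq hxy (y.2.trans x.2.symm))
      exact ⟨.nil, Nat.zero_le _⟩
    obtain ⟨v, hvy, hvx⟩ := SetLike.not_le_iff_exists.1 hxy
    have hlt : x.1 ⊓ y.1 < x.1 := by
      refine inf_le_left.lt_of_ne fun h' => hxy ?_
      rw [inf_eq_left] at h'
      exact (Submodule.eq_of_le_of_finrank_eq h' (x.2.trans y.2.symm)).ge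
    obtain ⟨H, hH, hHx⟩ := exists_le_covBy_of_lt hlt
    obtain ⟨u, hux, huH⟩ := SetLike.exists_of_lt hHx.lt
    have hHu : H ⊔ F ∙ u = x.1 := by
      refine (hHx.wcovBy.eq_or_eq le_sup_left
        (sup_le hHx.le ((Submodule.span_singleton_le_iff_mem _ _).2 hux))).resolve_left fun h' => ?_
      exact huH (h' ▸ le_sup_right (a := H) (Submodule.mem_span_singleton_self u))
    have hHr : finrank F H + 1 = k := by
      rw [← Submodule.finrank_sup_span_singleton huH, hHu, x.2]
    have hvH : v ∉ H := fun h => hvx (hHx.le h)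
    have hz : finrank F ↥(H ⊔ F ∙ v) = k := by
      rw [Submodule.finrank_sup_span_singleton hvH, hHr]
    have hadj : (Grass F V k).Adj x ⟨H ⊔ F ∙ v, hz⟩ := by
      rw [grass_adj_iff_of_finrank_sup]
      change finrank F ↥(x.1 ⊔ (H ⊔ F ∙ v)) = k + 1
      rw [← sup_assoc, sup_eq_left.2 hHx.le, Submodule.finrank_sup_span_singleton hvx, x.2]
    obtain ⟨p, hp⟩ := ih ⟨H ⊔ F ∙ v, hz⟩ (by
      have h2 : finrank F ↥((x.1 ⊓ y.1) ⊔ F ∙ v) ≤ finrank F ↥((H ⊔ F ∙ v) ⊓ y.1) :=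
        Submodule.finrank_mono (le_inf (sup_le_sup_right hH _)
          (sup_le inf_le_right ((Submodule.span_singleton_le_iff_mem _ _).2 hvy)))
      have hvy : v ∉ x.1 ⊓ y.1 := fun h => hvx (Submodule.mem_inf.1 h).1
      rw [Submodule.finrank_sup_span_singleton hvy] at h2
      change k ≤ finrank F ↥((H ⊔ F ∙ v) ⊓ y.1) + d
      omega)
    exact ⟨.cons hadj p, by rw [SimpleGraph.Walk.length_cons]; omega⟩

theorem finrank_inf_add_dist [FiniteDimensional F V] {k : ℕ} (x y : GrassVertex F V k) :
    finrank F ↥(x.1 ⊓ y.1) + (Grass F V k).dist x y = k := by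
  have h := Submodule.finrank_mono (inf_le_left : x.1 ⊓ y.1 ≤ x.1)
  rw [x.2] at h
  obtain ⟨d, hd⟩ := Nat.exists_eq_add_of_le h
  obtain ⟨p, hp⟩ := exists_walk_length_le y d x hd.le
  obtain ⟨p', hp'⟩ := p.reachable.exists_walk_length_eq_dist
  have h1 := le_finrank_inf_add_length p'
  have h2 := SimpleGraph.dist_le p
  omega

section EdgeTypes

variable [FiniteDimensional F V] {k : ℕ} {y a b : GrassVertex F V k}

theorem edgeType0_iff (h : (Grass F V k).Adj a b) :
    EdgeType0 y a b ↔ a.1 ⊓ y.1 = b.1 ⊓ y.1 ∧ a.1 ⊔ y.1 = b.1 ⊔ y.1 := by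
  have hs := grass_adj_iff_of_finrank_sup.1 h
  have hi := grass_adj_iff_of_finrank_inf.1 h
  have ha := finrank_sup_inf a.1 y.1
  have hb := finrank_sup_inf b.1 y.1
  have hab := finrank_sup_inf (a.1 ⊔ b.1) y.1
  have ha' : a.1 ⊔ y.1 ≤ (a.1 ⊔ b.1) ⊔ y.1 := sup_le_sup_right le_sup_left _
  have hb' : b.1 ⊔ y.1 ≤ (a.1 ⊔ b.1) ⊔ y.1 := sup_le_sup_right le_sup_right _
  have hia : (a.1 ⊓ b.1) ⊓ y.1 ≤ a.1 ⊓ y.1 := inf_le_inf_right _ inf_le_left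
  have hib : (a.1 ⊓ b.1) ⊓ y.1 ≤ b.1 ⊓ y.1 := inf_le_inf_right _ inf_le_right
  have hka := a.2
  have hkb := b.2
  have hky := y.2
  constructor
  · rintro ⟨⟨_, h1⟩, ⟨_, h2⟩, ⟨_, h3⟩, ⟨_, h4⟩⟩
    exact ⟨(Submodule.eq_of_le_of_finrank_eq hia h3.symm).symm.trans
      (Submodule.eq_of_le_of_finrank_eq hib h4.symm),
      (Submodule.eq_of_le_of_finrank_eq ha' (by omega)).trans
        (Submodule.eq_of_le_of_finrank_eq hb' (by omega)).symm⟩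
  · rintro ⟨h1, h2⟩
    have h3 : (a.1 ⊓ b.1) ⊓ y.1 = a.1 ⊓ y.1 :=
      le_antisymm hia (le_inf (le_inf inf_le_left (h1.le.trans inf_le_left)) inf_le_right)
    have h4 : (a.1 ⊔ b.1) ⊔ y.1 = a.1 ⊔ y.1 :=
      le_antisymm (sup_le (sup_le le_sup_left (le_sup_left.trans h2.ge)) le_sup_right) ha'
    rw [h4] at hab
    rw [← h2] at hb
    refine ⟨⟨⟨le_sup_left, ?_⟩, ?_⟩, ⟨⟨le_sup_right, ?_⟩, ?_⟩, ⟨⟨inf_le_left, ?_⟩, ?_⟩,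
      ⟨⟨inf_le_right, ?_⟩, ?_⟩⟩ <;> try omega
    · rw [h3]
    · rw [h3, h1]

theorem edgeTypeP_iff (h : (Grass F V k).Adj a b) :
    EdgeTypeP y a b ↔ a.1 ⊓ y.1 = b.1 ⊓ y.1 ∧ a.1 ⊔ y.1 ≠ b.1 ⊔ y.1 := by
  have hs := grass_adj_iff_of_finrank_sup.1 h
  have ha := finrank_sup_inf a.1 y.1
  have hb := finrank_sup_inf b.1 y.1
  have hab := finrank_sup_inf (a.1 ⊔ b.1) y.1
  have hia : a.1 ⊓ y.1 ≤ (a.1 ⊔ b.1) ⊓ y.1 := inf_le_inf_right _ le_sup_left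
  have hib : b.1 ⊓ y.1 ≤ (a.1 ⊔ b.1) ⊓ y.1 := inf_le_inf_right _ le_sup_right
  have hka := a.2
  have hkb := b.2
  have hky := y.2
  constructor
  · rintro ⟨⟨_, h1⟩, ⟨_, h2⟩⟩
    refine ⟨(Submodule.eq_of_le_of_finrank_eq hia h1.symm).trans
      (Submodule.eq_of_le_of_finrank_eq hib h2.symm).symm, fun h' => ?_⟩
    have h4 : (a.1 ⊔ b.1) ⊔ y.1 = a.1 ⊔ y.1 :=
      le_antisymm (sup_le (sup_le le_sup_left (le_sup_left.trans h'.ge)) le_sup_right)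
        (sup_le_sup_right le_sup_left _)
    rw [h4] at hab
    omega
  · rintro ⟨h1, h2⟩
    have h3 : finrank F ↥(a.1 ⊔ y.1) < finrank F ↥((a.1 ⊔ b.1) ⊔ y.1) := by
      refine Submodule.finrank_lt_finrank_of_lt
        ((sup_le_sup_right le_sup_left _).lt_of_ne fun h' => h2 ?_)
      refine (Submodule.eq_of_le_of_finrank_eq
        (h'.ge.trans' (sup_le_sup_right le_sup_right _)) ?_).symm
      rw [← h1] at hb
      omega
    have h4 := Submodule.finrank_mono hia
    rw [← h1] at hb
    refine ⟨⟨⟨le_sup_left, ?_⟩, ?_⟩, ⟨⟨le_sup_right, ?_⟩, ?_⟩⟩ <;> try omega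
    rw [← h1]
    omega

theorem edgeTypeM_iff (h : (Grass F V k).Adj a b) :
    EdgeTypeM y a b ↔ a.1 ⊓ y.1 ≠ b.1 ⊓ y.1 ∧ a.1 ⊔ y.1 = b.1 ⊔ y.1 := by
  have hi := grass_adj_iff_of_finrank_inf.1 h
  have ha := finrank_sup_inf a.1 y.1
  have hb := finrank_sup_inf b.1 y.1
  have hab := finrank_sup_inf (a.1 ⊓ b.1) y.1
  have hia : (a.1 ⊓ b.1) ⊔ y.1 ≤ a.1 ⊔ y.1 := sup_le_sup_right inf_le_left _
  have hib : (a.1 ⊓ b.1) ⊔ y.1 ≤ b.1 ⊔ y.1 := sup_le_sup_right inf_le_right _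
  have hka := a.2
  have hkb := b.2
  have hky := y.2
  constructor
  · rintro ⟨⟨_, h1⟩, ⟨_, h2⟩⟩
    refine ⟨fun h' => ?_, (Submodule.eq_of_le_of_finrank_eq hia (by omega)).symm.trans
      (Submodule.eq_of_le_of_finrank_eq hib (by omega))⟩
    have h4 : (a.1 ⊓ b.1) ⊓ y.1 = a.1 ⊓ y.1 :=
      le_antisymm (inf_le_inf_right _ inf_le_left)
        (le_inf (le_inf inf_le_left (h'.le.trans inf_le_left)) inf_le_right)
    rw [h4] at h1
    omega
  · rintro ⟨h1, h2⟩
    rw [← h2] at hb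
    have h3 : finrank F ↥((a.1 ⊓ b.1) ⊓ y.1) < finrank F ↥(a.1 ⊓ y.1) := by
      refine Submodule.finrank_lt_finrank_of_lt
        ((inf_le_inf_right _ inf_le_left).lt_of_ne fun h' => h1 ?_)
      exact Submodule.eq_of_le_of_finrank_eq
        (h'.ge.trans (inf_le_inf_right _ inf_le_right)) (by omega)
    have h4 := Submodule.finrank_mono hia
    refine ⟨⟨⟨inf_le_left, ?_⟩, ?_⟩, ⟨⟨inf_le_right, ?_⟩, ?_⟩⟩ <;> omega

variable {x w z : GrassVertex F V k}

theorem mem_A0set : z ∈ A0set x y ↔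
    (Grass F V k).Adj x z ∧ z.1 ⊓ y.1 = x.1 ⊓ y.1 ∧ z.1 ⊔ y.1 = x.1 ⊔ y.1 :=
  and_congr_right fun h => edgeType0_iff h.symm

theorem mem_Apset : z ∈ Apset x y ↔
    (Grass F V k).Adj x z ∧ z.1 ⊓ y.1 = x.1 ⊓ y.1 ∧ z.1 ⊔ y.1 ≠ x.1 ⊔ y.1 :=
  and_congr_right fun h => edgeTypeP_iff h.symm

theorem mem_Amset : z ∈ Amset x y ↔
    (Grass F V k).Adj x z ∧ z.1 ⊓ y.1 ≠ x.1 ⊓ y.1 ∧ z.1 ⊔ y.1 = x.1 ⊔ y.1 :=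
  and_congr_right fun h => edgeTypeM_iff h.symm

theorem mem_Apset_edgeTypeP_iff (hw : w ∈ A0set x y) :
    (z ∈ Apset x y ∧ (Grass F V k).Adj w z ∧ EdgeTypeP y w z) ↔
      x.1 ⊓ w.1 ≤ z.1 ∧ ¬ z.1 ≤ x.1 ⊔ y.1 := by
  obtain ⟨hxw, hE, hU⟩ := mem_A0set.1 hw
  have hH := grass_adj_iff_of_finrank_inf.1 hxw
  have hkz := z.2
  have hEH : x.1 ⊓ y.1 ≤ x.1 ⊓ w.1 := le_inf inf_le_left (hE.ge.trans inf_le_left)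
  rw [mem_Apset]
  constructor
  · rintro ⟨⟨hxz, h1, h2⟩, hwz, -⟩
    have hxz' := grass_adj_iff_of_finrank_inf.1 hxz
    have hwz' := grass_adj_iff_of_finrank_inf.1 hwz
    have hzU : ¬ z.1 ≤ x.1 ⊔ y.1 := by
      intro h
      refine h2 (Submodule.eq_of_le_of_finrank_eq (sup_le h le_sup_right) ?_)
      have hx := finrank_sup_inf x.1 y.1
      have hz := finrank_sup_inf z.1 y.1
      rw [h1] at hz
      have := x.2
      omega
    have hlt := Submodule.finrank_lt_finrank_of_lt
      (inf_le_left.lt_of_ne fun h => hzU (inf_eq_left.1 h) : z.1 ⊓ (x.1 ⊔ y.1) < z.1)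
    have hx : x.1 ⊓ z.1 = z.1 ⊓ (x.1 ⊔ y.1) :=
      Submodule.eq_of_le_of_finrank_le (le_inf inf_le_right (inf_le_left.trans le_sup_left))
        (by omega)
    have hw : w.1 ⊓ z.1 = z.1 ⊓ (x.1 ⊔ y.1) :=
      Submodule.eq_of_le_of_finrank_le
        (le_inf inf_le_right (inf_le_left.trans (le_sup_left.trans hU.le))) (by omega)
    have hzH : x.1 ⊓ z.1 ≤ x.1 ⊓ w.1 := le_inf inf_le_left ((hx.trans hw.symm).le.trans inf_le_left)
    exact ⟨(Submodule.eq_of_le_of_finrank_eq hzH (by omega)).ge.trans inf_le_right, hzU⟩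
  · rintro ⟨h1, h2⟩
    have hlt := Submodule.finrank_lt_finrank_of_lt
      (inf_le_left.lt_of_ne fun h => h2 (inf_eq_left.1 h) : z.1 ⊓ (x.1 ⊔ y.1) < z.1)
    have hzU : x.1 ⊓ w.1 = z.1 ⊓ (x.1 ⊔ y.1) :=
      Submodule.eq_of_le_of_finrank_le (le_inf h1 (inf_le_left.trans le_sup_left)) (by omega)
    have hx : x.1 ⊓ z.1 = x.1 ⊓ w.1 :=
      le_antisymm ((le_inf inf_le_right (inf_le_left.trans le_sup_left)).trans hzU.ge)
        (le_inf inf_le_left h1)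
    have hw : w.1 ⊓ z.1 = x.1 ⊓ w.1 :=
      le_antisymm ((le_inf inf_le_right (inf_le_left.trans (le_sup_left.trans hU.le))).trans hzU.ge)
        (le_inf inf_le_right h1)
    have hxz : (Grass F V k).Adj x z := grass_adj_iff_of_finrank_inf.2 (by rw [hx, hH])
    have hwz : (Grass F V k).Adj w z := grass_adj_iff_of_finrank_inf.2 (by rw [hw, hH])
    have hzE : z.1 ⊓ y.1 = x.1 ⊓ y.1 :=
      le_antisymm (le_inf ((inf_le_inf_left _ le_sup_right).trans (hzU.ge.trans inf_le_left))
        inf_le_right) (le_inf (hEH.trans h1) inf_le_right)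
    have hne : z.1 ⊔ y.1 ≠ x.1 ⊔ y.1 := fun h => h2 (le_sup_left.trans h.le)
    exact ⟨⟨hxz, hzE, hne⟩, hwz,
      (edgeTypeP_iff hwz).2 ⟨hE.trans hzE.symm, fun h => hne (h.symm.trans hU)⟩⟩

theorem mem_Amset_edgeTypeM_iff (hw : w ∈ A0set x y) :
    (z ∈ Amset x y ∧ (Grass F V k).Adj w z ∧ EdgeTypeM y w z) ↔
      z.1 ≤ x.1 ⊔ w.1 ∧ ¬ x.1 ⊓ y.1 ≤ z.1 := by
  obtain ⟨hxw, hE, hU⟩ := mem_A0set.1 hw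
  have hK := grass_adj_iff_of_finrank_sup.1 hxw
  have hkz := z.2
  have hkx := x.2
  have hkw := w.2
  have hKU : x.1 ⊔ w.1 ≤ x.1 ⊔ y.1 := sup_le le_sup_left (le_sup_left.trans hU.le)
  rw [mem_Amset]
  constructor
  · rintro ⟨⟨hxz, h1, h2⟩, hwz, -⟩
    have hxz' := grass_adj_iff_of_finrank_inf.1 hxz
    have hwz' := grass_adj_iff_of_finrank_inf.1 hwz
    have hzE : ¬ x.1 ⊓ y.1 ≤ z.1 := by
      intro h
      refine h1 (Submodule.eq_of_le_of_finrank_eq (le_inf h inf_le_right) ?_).symm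
      have hx := finrank_sup_inf x.1 y.1
      have hz := finrank_sup_inf z.1 y.1
      rw [h2] at hz
      omega
    have hx := sup_eq_of_finrank (inf_le_left : x.1 ⊓ z.1 ≤ x.1) (inf_le_left : x.1 ⊓ y.1 ≤ x.1)
      (by omega) fun h => hzE (h.trans inf_le_right)
    have hw := sup_eq_of_finrank (inf_le_left : w.1 ⊓ z.1 ≤ w.1) (hE.ge.trans inf_le_left)
      (by omega) fun h => hzE (h.trans inf_le_right)
    have hKz : x.1 ⊔ w.1 ≤ z.1 ⊔ (x.1 ⊓ y.1) :=
      sup_le (hx.ge.trans (sup_le_sup_right inf_le_right _))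
        (hw.ge.trans (sup_le_sup_right inf_le_right _))
    have hle : z.1 ⊔ (x.1 ⊓ y.1) ≤ x.1 ⊔ z.1 := sup_le le_sup_right (inf_le_left.trans le_sup_left)
    have hr := Submodule.finrank_mono hle
    rw [grass_adj_iff_of_finrank_sup.1 hxz] at hr
    exact ⟨le_sup_left.trans (Submodule.eq_of_le_of_finrank_le hKz (by omega)).ge, hzE⟩
  · rintro ⟨h1, h2⟩
    have hz : z.1 ⊔ (x.1 ⊓ y.1) = x.1 ⊔ w.1 :=
      sup_eq_of_finrank h1 (inf_le_left.trans le_sup_left) (by omega) h2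
    have hx : x.1 ⊔ z.1 = x.1 ⊔ w.1 :=
      le_antisymm (sup_le le_sup_left h1)
        (hz.ge.trans (sup_le le_sup_right (inf_le_left.trans le_sup_left)))
    have hw : w.1 ⊔ z.1 = x.1 ⊔ w.1 :=
      le_antisymm (sup_le le_sup_right h1)
        (hz.ge.trans (sup_le le_sup_right ((hE.ge.trans inf_le_left).trans le_sup_left)))
    have hxz : (Grass F V k).Adj x z := grass_adj_iff_of_finrank_sup.2 (by rw [hx, hK])
    have hwz : (Grass F V k).Adj w z := grass_adj_iff_of_finrank_sup.2 (by rw [hw, hK])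
    have hzU : z.1 ⊔ y.1 = x.1 ⊔ y.1 :=
      le_antisymm (sup_le (h1.trans hKU) le_sup_right)
        (sup_le (le_sup_left.trans (hz.ge.trans (sup_le_sup_left inf_le_right _))) le_sup_right)
    have hne : z.1 ⊓ y.1 ≠ x.1 ⊓ y.1 := fun h => h2 (h.ge.trans inf_le_left)
    exact ⟨⟨hxz, hne, hzU⟩, hwz,
      (edgeTypeM_iff hwz).2 ⟨fun h => hne (h.symm.trans hE), hU.trans hzU.symm⟩⟩

theorem mem_A0set_edgeType0_iff (hw : w ∈ A0set x y) :
    (z ∈ A0set x y ∧ (Grass F V k).Adj w z ∧ EdgeType0 y w z) ↔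
      z ≠ x ∧ z ≠ w ∧ ((x.1 ⊓ w.1 ≤ z.1 ∧ z.1 ≤ x.1 ⊔ y.1 ∧ ¬ z.1 ≤ (x.1 ⊓ w.1) ⊔ y.1) ∨
        (x.1 ⊓ y.1 ≤ z.1 ∧ z.1 ≤ x.1 ⊔ w.1 ∧ ¬ (x.1 ⊔ w.1) ⊓ y.1 ≤ z.1)) := by
  obtain ⟨hxw, hE, hU⟩ := mem_A0set.1 hw
  have hH := grass_adj_iff_of_finrank_inf.1 hxw
  have hK := grass_adj_iff_of_finrank_sup.1 hxw
  have hkz := z.2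
  have hkx := x.2
  have hkw := w.2
  have hKU : x.1 ⊔ w.1 ≤ x.1 ⊔ y.1 := sup_le le_sup_left (le_sup_left.trans hU.le)
  have hEH : x.1 ⊓ y.1 ≤ x.1 ⊓ w.1 := le_inf inf_le_left (hE.ge.trans inf_le_left)
  have hKy : (x.1 ⊔ w.1) ⊔ y.1 = x.1 ⊔ y.1 :=
    le_antisymm (sup_le hKU le_sup_right) (sup_le_sup_right le_sup_left _)
  have hrx := finrank_sup_inf x.1 y.1
  have hrz := finrank_sup_inf z.1 y.1
  have hrK := finrank_sup_inf (x.1 ⊔ w.1) y.1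
  rw [hKy] at hrK
  suffices h : z ≠ x → z ≠ w → (((Grass F V k).Adj x z ∧ (Grass F V k).Adj w z ∧
      z.1 ⊓ y.1 = x.1 ⊓ y.1 ∧ z.1 ⊔ y.1 = x.1 ⊔ y.1) ↔
      ((x.1 ⊓ w.1 ≤ z.1 ∧ z.1 ≤ x.1 ⊔ y.1 ∧ ¬ z.1 ≤ (x.1 ⊓ w.1) ⊔ y.1) ∨
        (x.1 ⊓ y.1 ≤ z.1 ∧ z.1 ≤ x.1 ⊔ w.1 ∧ ¬ (x.1 ⊔ w.1) ⊓ y.1 ≤ z.1))) by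
    rw [mem_A0set]
    constructor
    · rintro ⟨⟨hxz, h1, h2⟩, hwz, -⟩
      exact ⟨hxz.ne', hwz.ne', (h hxz.ne' hwz.ne').1 ⟨hxz, hwz, h1, h2⟩⟩
    · rintro ⟨hx, hw, h'⟩
      obtain ⟨hxz, hwz, h1, h2⟩ := (h hx hw).2 h'
      exact ⟨⟨hxz, h1, h2⟩, hwz, (edgeType0_iff hwz).2 ⟨hE.trans h1.symm, hU.trans h2.symm⟩⟩
  intro hzx hzw
  have hnx : ¬ z.1 ≤ x.1 := fun h =>
    hzx (Subtype.ext (Submodule.eq_of_le_of_finrank_eq h (hkz.trans hkx.symm)))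
  have hnw : ¬ z.1 ≤ w.1 := fun h =>
    hzw (Subtype.ext (Submodule.eq_of_le_of_finrank_eq h (hkz.trans hkw.symm)))
  constructor
  · rintro ⟨hxz, hwz, h1, h2⟩
    have hxz' := grass_adj_iff_of_finrank_inf.1 hxz
    have hwz' := grass_adj_iff_of_finrank_inf.1 hwz
    by_cases hc : x.1 ⊓ z.1 ≤ w.1 ⊓ z.1
    · left
      have hHz : x.1 ⊓ w.1 ≤ z.1 :=
        (Submodule.eq_of_le_of_finrank_eq (le_inf inf_le_left (hc.trans inf_le_left))
          (by omega : finrank F ↥(x.1 ⊓ z.1) = finrank F ↥(x.1 ⊓ w.1))).ge.trans inf_le_right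
      refine ⟨hHz, le_sup_left.trans h2.le, fun h => hnx ?_⟩
      calc z.1 ≤ ((x.1 ⊓ w.1) ⊔ y.1) ⊓ z.1 := le_inf h le_rfl
        _ = (x.1 ⊓ w.1) ⊔ (y.1 ⊓ z.1) := sup_inf_assoc_of_le _ hHz
        _ ≤ x.1 := sup_le inf_le_left (by rw [inf_comm, h1]; exact inf_le_left)
    · right
      have hz := sup_eq_of_finrank (inf_le_right : w.1 ⊓ z.1 ≤ z.1) inf_le_right (by omega) hc
      refine ⟨h1.ge.trans inf_le_left, ?_, fun h => ?_⟩
      · rw [← hz]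
        exact sup_le (inf_le_left.trans le_sup_right) (inf_le_left.trans le_sup_left)
      · have := Submodule.finrank_mono (le_inf h inf_le_right : (x.1 ⊔ w.1) ⊓ y.1 ≤ z.1 ⊓ y.1)
        rw [h1] at this
        omega
  · rintro (⟨h1, h2, h3⟩ | ⟨h1, h2, h3⟩)
    · have hlx := Submodule.finrank_lt_finrank_of_lt
        (inf_le_right.lt_of_ne fun h => hnx (inf_eq_right.1 h) : x.1 ⊓ z.1 < z.1)
      have hlw := Submodule.finrank_lt_finrank_of_lt
        (inf_le_right.lt_of_ne fun h => hnw (inf_eq_right.1 h) : w.1 ⊓ z.1 < z.1)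
      have hgx := Submodule.finrank_mono (le_inf inf_le_left h1 : x.1 ⊓ w.1 ≤ x.1 ⊓ z.1)
      have hgw := Submodule.finrank_mono (le_inf inf_le_right h1 : x.1 ⊓ w.1 ≤ w.1 ⊓ z.1)
      have hzy : z.1 ⊓ y.1 ≤ x.1 ⊓ w.1 := by
        by_contra hc
        refine h3 ?_
        rw [← sup_eq_of_finrank h1 inf_le_left (by omega) hc]
        exact sup_le_sup_left inf_le_right _
      have hzE : z.1 ⊓ y.1 = x.1 ⊓ y.1 :=
        le_antisymm (le_inf (hzy.trans inf_le_left) inf_le_right)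
          (le_inf (hEH.trans h1) inf_le_right)
      rw [hzE] at hrz
      exact ⟨grass_adj_iff_of_finrank_inf.2 (by omega), grass_adj_iff_of_finrank_inf.2 (by omega),
        hzE, Submodule.eq_of_le_of_finrank_eq (sup_le h2 le_sup_right) (by omega)⟩
    · have hx : x.1 ⊔ z.1 = x.1 ⊔ w.1 :=
        sup_eq_of_finrank le_sup_left h2 (by omega) hnx
      have hw : w.1 ⊔ z.1 = x.1 ⊔ w.1 :=
        sup_eq_of_finrank le_sup_right h2 (by omega) hnw
      have hlt : z.1 ⊓ y.1 < (x.1 ⊔ w.1) ⊓ y.1 :=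
        (inf_le_inf_right _ h2).lt_of_ne fun h => h3 (h.ge.trans inf_le_left)
      have hr := Submodule.finrank_lt_finrank_of_lt hlt
      have hzE : x.1 ⊓ y.1 = z.1 ⊓ y.1 :=
        Submodule.eq_of_le_of_finrank_le (le_inf h1 inf_le_right) (by omega)
      rw [← hzE] at hrz
      exact ⟨grass_adj_iff_of_finrank_sup.2 (by rw [hx, hK]),
        grass_adj_iff_of_finrank_sup.2 (by rw [hw, hK]), hzE.symm,
        Submodule.eq_of_le_of_finrank_eq (sup_le (h2.trans hKU) le_sup_right) (by omega)⟩

end EdgeTypes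

theorem eq_pow_mul_gaussQ {q : ℕ} (hq : 1 < q) {N : ℚ} {h s t : ℕ}
    (hN : N * ((q : ℚ) ^ (h + 1) - (q : ℚ) ^ h) = (q : ℚ) ^ (h + s + t) - (q : ℚ) ^ (h + s)) :
    N = (q : ℚ) ^ s * gaussQ q t := by
  have h1 : (q : ℚ) - 1 ≠ 0 := sub_ne_zero.2 (by exact_mod_cast hq.ne')
  have h2 : (q : ℚ) ^ h ≠ 0 := pow_ne_zero _ (by positivity)
  rw [gaussQ, mul_div_assoc', eq_div_iff h1]
  refine mul_left_cancel₀ h2 ?_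
  rw [pow_add _ (h + s), pow_add _ h s, pow_succ] at hN
  linear_combination hN

theorem gaussQ_one {q : ℕ} (hq : 1 < q) : gaussQ q 1 = 1 := by
  have h1 : (q : ℚ) - 1 ≠ 0 := sub_ne_zero.2 (by exact_mod_cast hq.ne')
  rw [gaussQ, pow_one, div_self h1]

theorem finrank_inf_of_dist [FiniteDimensional F V] {k i : ℕ} {x y : GrassVertex F V k}
    (hi : (Grass F V k).dist x y = i) :
    finrank F ↥(x.1 ⊓ y.1) + i = k ∧ finrank F ↥(x.1 ⊔ y.1) = k + i := by
  have h1 := finrank_inf_add_dist x y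
  have h2 := finrank_sup_inf x.1 y.1
  rw [x.2, y.2] at h2
  omega

section Counting

variable [Fintype F] [FiniteDimensional F V] {k i : ℕ} {x y w : GrassVertex F V k}

theorem ncard_Apset_edgeTypeP (hi : (Grass F V k).dist x y = i) (hw : w ∈ A0set x y) :
    ({z | z ∈ Apset x y ∧ (Grass F V k).Adj w z ∧ EdgeTypeP y w z}.ncard : ℚ) =
      (Fintype.card F : ℚ) ^ (i + 1) * gaussQ (Fintype.card F) (finrank F V - k - i) := by
  obtain ⟨hxw, hE, hU⟩ := mem_A0set.1 hw
  have hH := grass_adj_iff_of_finrank_inf.1 hxw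
  obtain ⟨-, hrU⟩ := finrank_inf_of_dist hi
  have hn := Submodule.finrank_le (x.1 ⊔ y.1)
  have key := ncard_extensions (inf_le_left.trans le_sup_left : x.1 ⊓ w.1 ≤ x.1 ⊔ y.1) le_top
  simp only [mem_Apset_edgeTypeP_iff hw]
  rw [ncard_grassVertex k fun z => x.1 ⊓ w.1 ≤ z ∧ ¬ z ≤ x.1 ⊔ y.1]
  simp only [hH, le_top, true_and, finrank_top] at key
  refine eq_pow_mul_gaussQ Fintype.one_lt_card (h := finrank F ↥(x.1 ⊓ w.1)) ?_
  rw [hH, key, hrU]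
  congr 2 <;> omega

theorem ncard_Amset_edgeTypeM (hi : (Grass F V k).dist x y = i) (hw : w ∈ A0set x y) :
    ({z | z ∈ Amset x y ∧ (Grass F V k).Adj w z ∧ EdgeTypeM y w z}.ncard : ℚ) =
      (Fintype.card F : ℚ) ^ (i + 1) * gaussQ (Fintype.card F) (k - i) := by
  obtain ⟨hxw, hE, hU⟩ := mem_A0set.1 hw
  have hK := grass_adj_iff_of_finrank_sup.1 hxw
  obtain ⟨hrE, -⟩ := finrank_inf_of_dist hi
  have hn := Submodule.finrank_le (x.1 ⊔ w.1)
  have key := ncard_hyperplanes bot_le (inf_le_left.trans le_sup_left : x.1 ⊓ y.1 ≤ x.1 ⊔ w.1)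
  simp only [mem_Amset_edgeTypeM_iff hw]
  rw [ncard_grassVertex k fun z => z ≤ x.1 ⊔ w.1 ∧ ¬ x.1 ⊓ y.1 ≤ z]
  simp only [hK, bot_le, true_and, finrank_bot, add_left_inj] at key
  refine eq_pow_mul_gaussQ Fintype.one_lt_card (h := finrank F V - (k + 1)) ?_
  rw [key]
  congr 2 <;> omega

theorem ncard_A0set_edgeType0 (hi : (Grass F V k).dist x y = i) (hi1 : 1 ≤ i)
    (hw : w ∈ A0set x y) :
    ({z | z ∈ A0set x y ∧ (Grass F V k).Adj w z ∧ EdgeType0 y w z}.ncard : ℚ) =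
      2 * (Fintype.card F : ℚ) ^ i - Fintype.card F - 2 := by
  have : Finite V := Module.finite_of_finite F
  have : Finite (Submodule F V) :=
    Finite.of_injective (fun U : Submodule F V => (U : Set V)) SetLike.coe_injective
  obtain ⟨hxw, hE, hU⟩ := mem_A0set.1 hw
  have hq : 1 < Fintype.card F := Fintype.one_lt_card
  have hH := grass_adj_iff_of_finrank_inf.1 hxw
  have hK := grass_adj_iff_of_finrank_sup.1 hxw
  have hkx := x.2
  have hkw := w.2
  have hky := y.2
  obtain ⟨hrE, hrU⟩ := finrank_inf_of_dist hi
  have hKU : x.1 ⊔ w.1 ≤ x.1 ⊔ y.1 := sup_le le_sup_left (le_sup_left.trans hU.le)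
  have hEH : x.1 ⊓ y.1 ≤ x.1 ⊓ w.1 := le_inf inf_le_left (hE.ge.trans inf_le_left)
  have hEK : x.1 ⊓ y.1 ≤ (x.1 ⊔ w.1) ⊓ y.1 := inf_le_inf_right _ le_sup_left
  have hKy : (x.1 ⊔ w.1) ⊔ y.1 = x.1 ⊔ y.1 :=
    le_antisymm (sup_le hKU le_sup_right) (sup_le_sup_right le_sup_left _)
  have hHy : (x.1 ⊓ w.1) ⊓ y.1 = x.1 ⊓ y.1 :=
    le_antisymm (inf_le_inf_right _ inf_le_left) (le_inf hEH inf_le_right)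
  have hHKy : (x.1 ⊓ w.1) ⊓ ((x.1 ⊔ w.1) ⊓ y.1) = x.1 ⊓ y.1 :=
    le_antisymm (le_inf (inf_le_left.trans inf_le_left) (inf_le_right.trans inf_le_right))
      (le_inf hEH hEK)
  have hrK := finrank_sup_inf (x.1 ⊔ w.1) y.1
  have hrHy := finrank_sup_inf (x.1 ⊓ w.1) y.1
  have hrHKy := finrank_sup_inf (x.1 ⊓ w.1) ((x.1 ⊔ w.1) ⊓ y.1)
  rw [hKy] at hrK
  rw [hHy] at hrHy
  rw [hHKy] at hrHKy
  have hn := Submodule.finrank_le (x.1 ⊔ y.1)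
  set A := {z : GrassVertex F V k |
    x.1 ⊓ w.1 ≤ z.1 ∧ z.1 ≤ x.1 ⊔ y.1 ∧ ¬ z.1 ≤ (x.1 ⊓ w.1) ⊔ y.1}
  set B := {z : GrassVertex F V k |
    x.1 ⊓ y.1 ≤ z.1 ∧ z.1 ≤ x.1 ⊔ w.1 ∧ ¬ (x.1 ⊔ w.1) ⊓ y.1 ≤ z.1}
  have hA : (A.ncard : ℚ) = (Fintype.card F : ℚ) ^ i := by
    have key := ncard_extensions (le_sup_left : x.1 ⊓ w.1 ≤ (x.1 ⊓ w.1) ⊔ y.1)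
      (sup_le_sup_right inf_le_left _ : (x.1 ⊓ w.1) ⊔ y.1 ≤ x.1 ⊔ y.1)
    simp only [hH] at key
    rw [ncard_grassVertex k fun z => x.1 ⊓ w.1 ≤ z ∧ z ≤ x.1 ⊔ y.1 ∧ ¬ z ≤ (x.1 ⊓ w.1) ⊔ y.1,
      ← mul_one (_ ^ i), ← gaussQ_one hq]
    refine eq_pow_mul_gaussQ hq (h := finrank F ↥(x.1 ⊓ w.1)) ?_
    rw [hH, key]
    congr 2 <;> omega
  have hB : (B.ncard : ℚ) = (Fintype.card F : ℚ) ^ i := by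
    have key := ncard_hyperplanes hEK inf_le_left
    simp only [hK, add_left_inj] at key
    rw [ncard_grassVertex k fun z => x.1 ⊓ y.1 ≤ z ∧ z ≤ x.1 ⊔ w.1 ∧ ¬ (x.1 ⊔ w.1) ⊓ y.1 ≤ z,
      ← mul_one (_ ^ i), ← gaussQ_one hq]
    refine eq_pow_mul_gaussQ hq (h := finrank F V - (k + 1)) ?_
    rw [key]
    congr 2 <;> omega
  have hABset : A ∩ B = {z : GrassVertex F V k | x.1 ⊓ w.1 ≤ z.1 ∧ z.1 ≤ x.1 ⊔ w.1 ∧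
      ¬ z.1 ≤ (x.1 ⊓ w.1) ⊔ ((x.1 ⊔ w.1) ⊓ y.1)} := by
    ext z
    constructor
    · rintro ⟨⟨h1, -, h3⟩, -, h5, -⟩
      exact ⟨h1, h5, fun h => h3 (h.trans (sup_le_sup_left inf_le_right _))⟩
    · rintro ⟨h1, h2, h3⟩
      refine ⟨⟨h1, h2.trans hKU, fun h => h3 ?_⟩, hEH.trans h1, h2, fun h => h3 ?_⟩
      · rw [inf_comm (x.1 ⊔ w.1), ← sup_inf_assoc_of_le _ (inf_le_left.trans le_sup_left)]
        exact le_inf h h2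
      · refine (Submodule.eq_of_le_of_finrank_eq (sup_le h1 h) ?_).ge
        have := z.2
        omega
  have hAB : ((A ∩ B).ncard : ℚ) = Fintype.card F := by
    have key := ncard_extensions
      (le_sup_left : x.1 ⊓ w.1 ≤ (x.1 ⊓ w.1) ⊔ ((x.1 ⊔ w.1) ⊓ y.1))
      (sup_le (inf_le_left.trans le_sup_left) inf_le_left :
        (x.1 ⊓ w.1) ⊔ ((x.1 ⊔ w.1) ⊓ y.1) ≤ x.1 ⊔ w.1)
    simp only [hH] at key
    rw [hABset, ncard_grassVertex k fun z => x.1 ⊓ w.1 ≤ z ∧ z ≤ x.1 ⊔ w.1 ∧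
        ¬ z ≤ (x.1 ⊓ w.1) ⊔ ((x.1 ⊔ w.1) ⊓ y.1),
      ← mul_one (Fintype.card F : ℚ), ← gaussQ_one hq]
    nth_rewrite 1 [← pow_one (Fintype.card F : ℚ)]
    refine eq_pow_mul_gaussQ hq (h := finrank F ↥(x.1 ⊓ w.1)) ?_
    rw [hH, key]
    congr 2
    omega
  have hxB : x ∈ B := ⟨inf_le_left, le_sup_left, fun h => by
    have := Submodule.finrank_mono (le_inf h inf_le_right : _ ≤ x.1 ⊓ y.1)
    omega⟩
  have hwB : w ∈ B := ⟨hE.ge.trans inf_le_left, le_sup_right, fun h => by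
    have := Submodule.finrank_mono (le_inf h inf_le_right : _ ≤ w.1 ⊓ y.1)
    rw [hE] at this
    omega⟩
  have hS : {z | z ∈ A0set x y ∧ (Grass F V k).Adj w z ∧ EdgeType0 y w z} = (A ∪ B) \ {x, w} := by
    ext z
    rw [Set.mem_sdiff, Set.mem_insert_iff, Set.mem_singleton_iff, not_or]
    exact (mem_A0set_edgeType0_iff hw).trans (and_assoc.symm.trans and_comm)
  have hsub : ({x, w} : Set (GrassVertex F V k)) ⊆ A ∪ B :=
    Set.insert_subset (Or.inr hxB) (Set.singleton_subset_iff.2 (Or.inr hwB))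
  have h1 := Set.ncard_sdiff_add_ncard_of_subset hsub
  rw [← hS, Set.ncard_pair hxw.ne] at h1
  have h2 := Set.ncard_union_add_ncard_inter A B
  have h1' : ({z | z ∈ A0set x y ∧ (Grass F V k).Adj w z ∧ EdgeType0 y w z}.ncard : ℚ) + 2 =
    (A ∪ B).ncard := by exact_mod_cast h1
  have h2' : ((A ∪ B).ncard : ℚ) + (A ∩ B).ncard = A.ncard + B.ncard := by exact_mod_cast h2
  rw [hA, hB, hAB] at h2'
  linarith

end Counting

theorem statement17
    (q n k : ℕ) (hq : IsPrimePow q) (hkn : 2 * k < n) (hk : 3 ≤ k)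
    (F V : Type) [Field F] [Fintype F] (hcard : Fintype.card F = q)
    [AddCommGroup V] [Module F V] [FiniteDimensional F V]
    (hdim : Module.finrank F V = n)
    [Fintype (Submodule F V)]
    (x y : GrassVertex F V k)
    (i : ℕ) (hi : (Grass F V k).dist x y = i) (hi1 : 1 < i) (hi2 : i < k)
    (w : GrassVertex F V k) (hw : w ∈ A0set x y) :
    ({z | z ∈ A0set x y ∧ (Grass F V k).Adj w z ∧ EdgeType0 y w z}.ncard : ℚ) = 2 * (q : ℚ) ^ i - q - 2 ∧
    ({z | z ∈ A0set x y ∧ (Grass F V k).Adj w z ∧ EdgeTypeP y w z}.ncard : ℚ) = 0 ∧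
    ({z | z ∈ A0set x y ∧ (Grass F V k).Adj w z ∧ EdgeTypeM y w z}.ncard : ℚ) = 0 ∧
    ({z | z ∈ Apset x y ∧ (Grass F V k).Adj w z ∧ EdgeType0 y w z}.ncard : ℚ) = 0 ∧
    ({z | z ∈ Apset x y ∧ (Grass F V k).Adj w z ∧ EdgeTypeP y w z}.ncard : ℚ) = (q : ℚ) ^ (i + 1) * gaussQ q (n - k - i) ∧
    ({z | z ∈ Apset x y ∧ (Grass F V k).Adj w z ∧ EdgeTypeM y w z}.ncard : ℚ) = 0 ∧
    ({z | z ∈ Amset x y ∧ (Grass F V k).Adj w z ∧ EdgeType0 y w z}.ncard : ℚ) = 0 ∧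
    ({z | z ∈ Amset x y ∧ (Grass F V k).Adj w z ∧ EdgeTypeP y w z}.ncard : ℚ) = 0 ∧
    ({z | z ∈ Amset x y ∧ (Grass F V k).Adj w z ∧ EdgeTypeM y w z}.ncard : ℚ) = (q : ℚ) ^ (i + 1) * gaussQ q (k - i) := by
  subst hcard hdim
  have hzero {S : Set (GrassVertex F V k)} (h : ∀ z, z ∉ S) : (S.ncard : ℚ) = 0 := by
    rw [Set.eq_empty_of_forall_notMem h, Set.ncard_empty, Nat.cast_zero]
  obtain ⟨-, hE, hU⟩ := mem_A0set.1 hw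
  refine ⟨ncard_A0set_edgeType0 hi hi1.le hw, hzero ?_, hzero ?_, hzero ?_,
    ncard_Apset_edgeTypeP hi hw, hzero ?_, hzero ?_, hzero ?_, ncard_Amset_edgeTypeM hi hw⟩
  · rintro z ⟨h1, h2, h3⟩
    exact ((edgeTypeP_iff h2).1 h3).2 (hU.trans (mem_A0set.1 h1).2.2.symm)
  · rintro z ⟨h1, h2, h3⟩
    exact ((edgeTypeM_iff h2).1 h3).1 (hE.trans (mem_A0set.1 h1).2.1.symm)
  · rintro z ⟨h1, h2, h3⟩
    exact (mem_Apset.1 h1).2.2 (((edgeType0_iff h2).1 h3).2.symm.trans hU)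
  · rintro z ⟨h1, h2, h3⟩
    exact ((edgeTypeM_iff h2).1 h3).1 (hE.trans (mem_Apset.1 h1).2.1.symm)
  · rintro z ⟨h1, h2, h3⟩
    exact (mem_Amset.1 h1).2.1 (((edgeType0_iff h2).1 h3).1.symm.trans hE)
  · rintro z ⟨h1, h2, h3⟩
    exact (mem_Amset.1 h1).2.1 (((edgeTypeP_iff h2).1 h3).1.symm.trans hE)
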